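/- Given a descent datum (M_f, M̂, ρ), let N be the R-module N = {(m, m̂) ∈ M_f × M̂ : ρ(1 ⊗ m) = 1 ⊗ m̂} (the fiber product of M_f and M̂ over R̂_f ⊗_{R̂} M̂). Then the natural R̂-linear map R̂ ⊗_R N → M̂ sending r̂ ⊗ (m, m̂) to r̂ · m̂ is an isomorphism. -/

import Mathlib

open TensorProduct

set_option maxHeartbeats 1000000
set_option synthInstance.maxHeartbeats 400000

noncomputable section

variable (R : Type*) [CommRing R] (f : R)

/-- The `(f)`-adic completion `R̂` of `R`. -/
abbrev Rhat : Type _ := AdicCompletion (Ideal.span {f}) R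

/-- The localization `R_f = R[f⁻¹]`. -/
abbrev Rf : Type _ := Localization.Away f

/-- The localization `R̂_f = R̂[ι(f)⁻¹]`. -/
abbrev Rhatf : Type _ := Localization.Away (algebraMap R (Rhat R f) f)

/-- The canonical map `R_f → R̂_f` extending `ι : R → R̂` (as an `R`-algebra map). -/
noncomputable def psiAlg : Rf R f →ₐ[R] Rhatf R f :=
  Localization.awayMapₐ (Algebra.ofId R (Rhat R f)) f

/-- `R̂_f` is an `R_f`-algebra via the canonical map `R_f → R̂_f`. -/
noncomputable instance : Algebra (Rf R f) (Rhatf R f) :=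
  (psiAlg R f).toRingHom.toAlgebra

variable (Mf : Type*) [AddCommGroup Mf] [Module R Mf] [Module (Rf R f) Mf]
  [IsScalarTower R (Rf R f) Mf]
variable (Mh : Type*) [AddCommGroup Mh] [Module R Mh] [Module (Rhat R f) Mh]
  [IsScalarTower R (Rhat R f) Mh]

/-- The `R`-module `N = {(m, m̂) ∈ M_f × M̂ : ρ(1 ⊗ m) = 1 ⊗ m̂}`,
the fiber product of `M_f` and `M̂` over `R̂_f ⊗_{R̂} M̂`. -/
noncomputable def descentN
    (ρ : (Rhatf R f ⊗[Rf R f] Mf) ≃ₗ[Rhatf R f] (Rhatf R f ⊗[Rhat R f] Mh)) :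
    Submodule R (Mf × Mh) where
  carrier := {p | ρ ((1 : Rhatf R f) ⊗ₜ[Rf R f] p.1) = (1 : Rhatf R f) ⊗ₜ[Rhat R f] p.2}
  add_mem' {a b} ha hb := by
    simp only [Set.mem_setOf_eq, Prod.fst_add, Prod.snd_add, tmul_add, map_add] at *
    rw [ha, hb]
  zero_mem' := by
    simp only [Set.mem_setOf_eq, Prod.fst_zero, Prod.snd_zero, tmul_zero, map_zero]
  smul_mem' r p hp := by
    simp only [Set.mem_setOf_eq, Prod.smul_fst, Prod.smul_snd] at *
    have e1 : (1 : Rhatf R f) ⊗ₜ[Rf R f] (r • p.1)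
        = (algebraMap R (Rhatf R f) r) • ((1 : Rhatf R f) ⊗ₜ[Rf R f] p.1) := by
      rw [← algebraMap_smul (Rf R f) r p.1, tmul_smul, algebraMap_smul, algebraMap_smul]
    have e2 : (1 : Rhatf R f) ⊗ₜ[Rhat R f] (r • p.2)
        = (algebraMap R (Rhatf R f) r) • ((1 : Rhatf R f) ⊗ₜ[Rhat R f] p.2) := by
      rw [← algebraMap_smul (Rhat R f) r p.2, tmul_smul, algebraMap_smul, algebraMap_smul]
    rw [e1, e2, map_smul, hp]

lemma AdicCompletion.exists_eq_algebraMap_add_pow_mul {R : Type*} [CommRing R] (f : R) (n : ℕ)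
    (s : AdicCompletion (Ideal.span {f}) R) :
    ∃ (r : R) (t : AdicCompletion (Ideal.span {f}) R),
      s = algebraMap R _ r + algebraMap R _ f ^ n * t := by
  obtain ⟨r, hr⟩ := Submodule.Quotient.mk_surjective _ (s.val n)
  have hker : s - algebraMap R _ r ∈
      (AdicCompletion.eval (Ideal.span {f}) R n).ker := by
    rw [LinearMap.mem_ker, map_sub, AdicCompletion.eval_apply, ← hr, sub_eq_zero]
    rfl
  rw [← AdicCompletion.pow_smul_top_eq_ker_eval (Submodule.fg_span_singleton f),
    Ideal.span_singleton_pow, Submodule.ideal_span_singleton_smul,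
    Submodule.mem_smul_pointwise_iff_exists] at hker
  obtain ⟨t, -, ht⟩ := hker
  refine ⟨r, t, ?_⟩
  rw [← map_pow, ← Algebra.smul_def, ht]
  abel

section LocalizationAway

variable {S S' M' : Type*} [CommRing S] [CommRing S'] [Algebra S S'] [AddCommGroup M'] [Module S M']
  (a : S) [IsLocalization.Away a S']

lemma isLocalizedModule_powers_tensorProduct_mk :
    IsLocalizedModule (Submonoid.powers a) (TensorProduct.mk S S' M' 1) :=
  (isLocalizedModule_iff_isBaseChange _ S' _).2 (TensorProduct.isBaseChange S M' S')

lemma exists_pow_smul_eq_one_tmul (p : S' ⊗[S] M') :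
    ∃ (n : ℕ) (x : M'), a ^ n • p = 1 ⊗ₜ[S] x := by
  have := isLocalizedModule_powers_tensorProduct_mk (S' := S') (M' := M') a
  obtain ⟨⟨x, _, n, rfl⟩, hx⟩ := IsLocalizedModule.surj
    (Submonoid.powers a) (TensorProduct.mk S S' M' 1) p
  exact ⟨n, x, hx⟩

lemma exists_pow_smul_eq_zero_of_one_tmul_eq_zero {x : M'} (hx : (1 : S') ⊗ₜ[S] x = 0) :
    ∃ n : ℕ, a ^ n • x = 0 := by
  have := isLocalizedModule_powers_tensorProduct_mk (S' := S') (M' := M') a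
  obtain ⟨⟨_, n, rfl⟩, hn⟩ := (IsLocalizedModule.eq_zero_iff
    (Submonoid.powers a) (TensorProduct.mk S S' M' 1)).1 hx
  exact ⟨n, hn⟩

end LocalizationAway

section FiberProduct

variable {R S R' S' M M' : Type*} [CommRing R] [CommRing S] [CommRing R'] [CommRing S']
  [Algebra R S] [Algebra R R'] [Algebra R S'] [Algebra S S'] [Algebra R' S']
  [IsScalarTower R S S'] [IsScalarTower R R' S']
  [AddCommGroup M] [Module R M] [Module R' M] [IsScalarTower R R' M]
  [AddCommGroup M'] [Module R M'] [Module S M'] [IsScalarTower R S M']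

lemma isPushout_of_isLocalization_away (f : R) [IsLocalization.Away f R']
    [IsLocalization.Away (algebraMap R S f) S'] : Algebra.IsPushout R S R' S' := by
  have : IsLocalization (Algebra.algebraMapSubmonoid S (Submonoid.powers f)) S' := by
    rwa [Algebra.algebraMapSubmonoid, Submonoid.map_powers]
  exact Algebra.isPushout_of_isLocalization (Submonoid.powers f) R' S S'

lemma one_tmul_smul_left (r : R) (m : M) :
    (1 : S') ⊗ₜ[R'] (r • m) = algebraMap R S' r • ((1 : S') ⊗ₜ[R'] m) := by
  rw [← algebraMap_smul R' r m, tmul_smul, ← algebraMap_smul S' (algebraMap R R' r),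
    ← IsScalarTower.algebraMap_apply]

lemma one_tmul_smul_right (s : S) (x : M') :
    (1 : S') ⊗ₜ[S] (s • x) = algebraMap S S' s • ((1 : S') ⊗ₜ[S] x) := by
  rw [tmul_smul, algebraMap_smul]

variable (f : R) [IsLocalization.Away f R'] [IsLocalization.Away (algebraMap R S f) S']

/-- Every element of `S' ⊗[S] M'` comes from `M` up to the image of `S ⊗[R] N`. -/
lemma exists_eq_one_tmul_add_liftBaseChange
    (hS : ∀ (n : ℕ) (s : S), ∃ (r : R) (t : S), s = algebraMap R S r + algebraMap R S f ^ n * t)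
    (ρ : (S' ⊗[R'] M) ≃ₗ[S'] (S' ⊗[S] M'))
    (N : Submodule R (M × M'))
    (hN : ∀ p, p ∈ N ↔ ρ (1 ⊗ₜ[R'] p.1) = 1 ⊗ₜ[S] p.2)
    (p : S' ⊗[R'] M) :
    ∃ (m : M) (y : S ⊗[R] N), ρ p = ρ (1 ⊗ₜ[R'] m) +
      1 ⊗ₜ[S] (((LinearMap.snd R M M').comp N.subtype).liftBaseChange S y) := by
  have hpush := isPushout_of_isLocalization_away (S := S) (R' := R') (S' := S') f
  obtain ⟨q, rfl⟩ := (Algebra.IsPushout.cancelBaseChange R S R' S' M).symm.surjective p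
  induction q with
  | zero => exact ⟨0, 0, by simp⟩
  | add p q hp hq =>
    obtain ⟨m₁, y₁, h₁⟩ := hp
    obtain ⟨m₂, y₂, h₂⟩ := hq
    refine ⟨m₁ + m₂, y₁ + y₂, ?_⟩
    simp only [map_add, tmul_add, h₁, h₂]
    abel
  | tmul s m =>
    obtain ⟨n, x, hx⟩ := exists_pow_smul_eq_one_tmul (algebraMap R S f) (ρ (1 ⊗ₜ[R'] m))
    rw [← algebraMap_smul S' (algebraMap R S f ^ n), map_pow,
      ← IsScalarTower.algebraMap_apply] at hx
    obtain ⟨r, t, rfl⟩ := hS n s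
    have hmem : (f ^ n • m, x) ∈ N := by
      rw [hN, one_tmul_smul_left, map_smul, map_pow, hx]
    refine ⟨r • m, t ⊗ₜ ⟨_, hmem⟩, ?_⟩
    rw [Algebra.IsPushout.cancelBaseChange_symm_tmul, LinearMap.liftBaseChange_tmul,
      ← mul_one (algebraMap S S' _), ← smul_eq_mul, ← smul_tmul', map_smul, one_tmul_smul_left,
      map_smul, map_add, add_smul, ← IsScalarTower.algebraMap_apply]
    congr 1
    rw [mul_comm, map_mul, mul_smul, map_pow, ← IsScalarTower.algebraMap_apply, hx]
    exact (one_tmul_smul_right _ _).symm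

lemma liftBaseChange_snd_surjective
    (hS : ∀ (n : ℕ) (s : S), ∃ (r : R) (t : S), s = algebraMap R S r + algebraMap R S f ^ n * t)
    (ρ : (S' ⊗[R'] M) ≃ₗ[S'] (S' ⊗[S] M'))
    (N : Submodule R (M × M'))
    (hN : ∀ p, p ∈ N ↔ ρ (1 ⊗ₜ[R'] p.1) = 1 ⊗ₜ[S] p.2) :
    Function.Surjective (((LinearMap.snd R M M').comp N.subtype).liftBaseChange S) := by
  intro x
  obtain ⟨m, y, h⟩ := exists_eq_one_tmul_add_liftBaseChange f hS ρ N hN (ρ.symm (1 ⊗ₜ[S] x))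
  rw [ρ.apply_symm_apply] at h
  have hmem : (m, x - ((LinearMap.snd R M M').comp N.subtype).liftBaseChange S y) ∈ N := by
    rw [hN, tmul_sub, h, add_sub_cancel_right]
  exact ⟨1 ⊗ₜ ⟨_, hmem⟩ + y, by simp⟩

/-- An element of the kernel of `S ⊗[R] N → M'` is killed in `S ⊗[R] M = S' ⊗[R'] M`, hence comes
from the `f`-power torsion of `M'`, on which `S ⊗[R] -` acts trivially. -/
lemma liftBaseChange_snd_injective [Module.Flat R S]
    (hS : ∀ (n : ℕ) (s : S), ∃ (r : R) (t : S), s = algebraMap R S r + algebraMap R S f ^ n * t)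
    (ρ : (S' ⊗[R'] M) ≃ₗ[S'] (S' ⊗[S] M'))
    (N : Submodule R (M × M'))
    (hN : ∀ p, p ∈ N ↔ ρ (1 ⊗ₜ[R'] p.1) = 1 ⊗ₜ[S] p.2) :
    Function.Injective (((LinearMap.snd R M M').comp N.subtype).liftBaseChange S) := by
  have hpush := isPushout_of_isLocalization_away (S := S) (R' := R') (S' := S') f
  set φ := ((LinearMap.snd R M M').comp N.subtype).liftBaseChange S
  let π : N →ₗ[R] M := (LinearMap.fst R M M').comp N.subtype
  let e := (Algebra.IsPushout.cancelBaseChange R S R' S' M).symm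
  have hcomm (x : S ⊗[R] N) : ρ (e (π.lTensor S x)) = 1 ⊗ₜ[S] φ x := by
    induction x with
    | zero => simp
    | add x y hx hy => simp only [map_add, tmul_add, hx, hy]
    | tmul s n =>
      rw [LinearMap.lTensor_tmul, Algebra.IsPushout.cancelBaseChange_symm_tmul,
        LinearMap.liftBaseChange_tmul, ← mul_one (algebraMap S S' _), ← smul_eq_mul,
        ← smul_tmul', map_smul, one_tmul_smul_right]
      exact congrArg _ ((hN _).1 n.2)
  have htorsion (z : S ⊗[R] LinearMap.ker π) : ∃ t, z = 1 ⊗ₜ t := by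
    induction z with
    | zero => exact ⟨0, by simp⟩
    | add x y hx hy =>
      obtain ⟨t, rfl⟩ := hx
      obtain ⟨u, rfl⟩ := hy
      exact ⟨t + u, (tmul_add _ _ _).symm⟩
    | tmul s t =>
      obtain ⟨⟨⟨m, x⟩, hmx⟩, rfl : m = 0⟩ := t
      have hx : (1 : S') ⊗ₜ[S] x = 0 := by
        have := (hN _).1 hmx
        rwa [tmul_zero, map_zero, eq_comm] at this
      obtain ⟨n, hn⟩ := exists_pow_smul_eq_zero_of_one_tmul_eq_zero (algebraMap R S f) hx
      rw [← map_pow, algebraMap_smul] at hn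
      obtain ⟨r, u, rfl⟩ := hS n s
      refine ⟨r • ⟨⟨(0, x), hmx⟩, rfl⟩, ?_⟩
      rw [add_tmul, ← map_pow, ← Algebra.smul_def, smul_tmul, Algebra.algebraMap_eq_smul_one,
        smul_tmul, add_eq_left]
      have h0 : f ^ n • (⟨⟨(0, x), hmx⟩, rfl⟩ : LinearMap.ker π) = 0 :=
        Subtype.ext <| Subtype.ext <| Prod.ext (smul_zero _) hn
      rw [h0, tmul_zero]
  have hexact : Function.Exact ((LinearMap.ker π).subtype.lTensor S) (π.lTensor S) :=
    Module.Flat.lTensor_exact (N := LinearMap.ker π) (N' := N) (N'' := M) S π.exact_subtype_ker_map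
  rw [injective_iff_map_eq_zero]
  intro x hx
  have hker : π.lTensor S x = 0 := by
    rw [← e.map_eq_zero_iff, ← ρ.map_eq_zero_iff, hcomm, hx, tmul_zero]
  obtain ⟨z, rfl⟩ := (hexact x).1 hker
  obtain ⟨⟨⟨⟨m, x⟩, hmx⟩, rfl : m = 0⟩, rfl⟩ := htorsion z
  have hx0 : x = 0 := by simpa [φ] using hx
  subst hx0
  exact tmul_zero _ _

end FiberProduct

/-- for a descent datum `(M_f, M̂, ρ)` with fiber product `N`, the natural
`R̂`-linear map `R̂ ⊗_R N → M̂`, `r̂ ⊗ (m, m̂) ↦ r̂ • m̂`, is an isomorphism. -/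
theorem stmt7 [IsNoetherianRing R] (hf : f ∈ nonZeroDivisors R)
    (ρ : (Rhatf R f ⊗[Rf R f] Mf) ≃ₗ[Rhatf R f] (Rhatf R f ⊗[Rhat R f] Mh)) :
    Function.Bijective
      (LinearMap.liftBaseChange (Rhat R f)
        ((LinearMap.snd R Mf Mh).comp (descentN R f Mf Mh ρ).subtype)) := by
  have hS := AdicCompletion.exists_eq_algebraMap_add_pow_mul f
  have : IsScalarTower R (Rf R f) (Rhatf R f) := .of_algebraMap_eq' (psiAlg R f).comp_algebraMap.symm
  exact ⟨liftBaseChange_snd_injective f hS ρ _ fun _ ↦ Iff.rfl,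
    liftBaseChange_snd_surjective f hS ρ _ fun _ ↦ Iff.rfl⟩
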